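/- arXiv:1902.06234 — 2 statements merged into one kernel-verified Lean document; each statement's English description precedes it below -/
import Mathlib

section
/- Let R be a commutative ring, q ∈ R, and let A be an n×n matrix over R with n ≥ 2. Let A₁¹, Aₙⁿ, Aₙ¹, A₁ⁿ denote the (n−1)×(n−1) submatrices of A obtained by deleting (row 1, column 1), (row n, column n), (row n, column 1), (row 1, column n) respectively, and let A_{1n}^{1n} denote the (n−2)×(n−2) submatrix obtained by deleting rows 1 and n and columns 1 and n. Then the bigrassmannian determinant satisfies the weighted condensation identity bdet(A)·bdet(A_{1n}^{1n}) = bdet(A₁¹)·bdet(Aₙⁿ) − q^{n−1}·bdet(Aₙ¹)·bdet(A₁ⁿ). -/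
/-- The length ℓ(w) = |N(w)|, the number of inversions of `w`, where
N(w) = {(i,j) : i < j and w⁻¹(i) > w⁻¹(j)}. -/
def permLen {m : ℕ} (w : Equiv.Perm (Fin m)) : ℕ :=
  (Finset.univ.filter
    (fun p : Fin m × Fin m => p.1 < p.2 ∧ w⁻¹ p.2 < w⁻¹ p.1)).card

/-- The bigrassmannian statistic β(w) = Σ_{(i,j)∈N(w)} (j−i). -/
def permBeta {m : ℕ} (w : Equiv.Perm (Fin m)) : ℕ :=
  ∑ p ∈ Finset.univ.filter
      (fun p : Fin m × Fin m => p.1 < p.2 ∧ w⁻¹ p.2 < w⁻¹ p.1),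
    ((p.2 : ℕ) - (p.1 : ℕ))

/-- The bigrassmannian determinant
bdet(M) = Σ_{w∈S_m} (−1)^{ℓ(w)} q^{β(w)} ∏_i m_{i,w(i)}
(for m = 0 this is the empty sum over the trivial group, i.e. 1). -/
def bdet {R : Type*} [CommRing R] (q : R) {m : ℕ}
    (M : Matrix (Fin m) (Fin m) R) : R :=
  ∑ w : Equiv.Perm (Fin m),
    (-1 : R) ^ permLen w * q ^ permBeta w * ∏ i : Fin m, M i (w i)

open Matrix in
/-- The determinant of the identity matrix with two columns replaced. -/
theorem det_one_updateCol_updateCol {n R : Type*} [Fintype n] [DecidableEq n] [CommRing R]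
    {a b : n} (hab : a ≠ b) (u v : n → R) :
    (((1 : Matrix n n R).updateCol a u).updateCol b v).det = u a * v b - v a * u b := by
  have h : ((1 : Matrix n n R).updateCol a u).updateCol b v =
      1 + (Matrix.of fun i (k : Fin 2) =>
          if k = 0 then u i - (1 : Matrix n n R) i a else v i - (1 : Matrix n n R) i b) *
        (Matrix.of fun (k : Fin 2) j =>
          if k = 0 then (1 : Matrix n n R) a j else (1 : Matrix n n R) b j) := by
    ext i j
    rw [Matrix.add_apply, mul_apply, Fin.sum_univ_two]
    simp only [updateCol_apply, of_apply, one_apply]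
    rcases eq_or_ne j a with rfl | h0
    · simp [hab, hab.symm]
    · rcases eq_or_ne j b with rfl | h1
      · simp [hab]
      · simp [h0, h1, h0.symm, h1.symm]
  rw [h, det_one_add_mul_comm, det_fin_two]
  simp [mul_apply, one_apply, hab, hab.symm]

open Matrix in
theorem det_updateCol_zero_single_updateCol_last_single {R : Type*} [CommRing R] (m : ℕ)
    (A : Matrix (Fin (m + 2)) (Fin (m + 2)) R) (c d : R) :
    ((A.updateCol 0 (Pi.single 0 c)).updateCol (Fin.last _) (Pi.single (Fin.last _) d)).det
      = d * (c * (A.submatrix (fun i : Fin m => i.succ.castSucc)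
        (fun j : Fin m => j.succ.castSucc)).det) := by
  set B := (A.updateCol 0 (Pi.single 0 c)).updateCol (Fin.last _) (Pi.single (Fin.last _) d)
    with hB
  have hcol : ∀ i : Fin (m + 1), B.submatrix Fin.castSucc Fin.castSucc i 0 =
      (Pi.single 0 c : Fin (m + 1) → R) i := by
    intro i
    rw [submatrix_apply, Fin.castSucc_zero, hB, updateCol_ne Fin.last_pos.ne,
      updateCol_self]
    rcases eq_or_ne i 0 with rfl | hi
    · simp
    · rw [Pi.single_eq_of_ne hi, Pi.single_eq_of_ne (Fin.castSucc_ne_zero_iff.2 hi)]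
  have hinner : (B.submatrix Fin.castSucc Fin.castSucc).submatrix Fin.succ Fin.succ =
      A.submatrix (fun i : Fin m => i.succ.castSucc) (fun j : Fin m => j.succ.castSucc) := by
    ext i j
    simp [hB, Fin.ext_iff, j.isLt.ne]
  have hlast : B.det = d * (B.submatrix Fin.castSucc Fin.castSucc).det := by
    rw [det_succ_column _ (Fin.last _), Finset.sum_eq_single (Fin.last _)]
    · rw [Even.neg_one_pow ⟨_, rfl⟩]
      simp [hB, Fin.succAbove_last]
    · intro i _ hi
      simp [hB, hi]
    · simp
  rw [hlast, det_succ_column_zero, Finset.sum_eq_single 0]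
  · rw [hcol, ← hinner]
    simp [Fin.succAbove_zero]
  · intro i _ hi
    rw [hcol]
    simp [hi]
  · simp

open Matrix in
/-- The Desnanot–Jacobi identity multiplied by the determinant. -/
theorem det_mul_det_mul_inner {R : Type*} [CommRing R] (m : ℕ)
    (A : Matrix (Fin (m + 2)) (Fin (m + 2)) R) :
    A.det * (A.det * (A.submatrix (fun i : Fin m => i.succ.castSucc)
        (fun j : Fin m => j.succ.castSucc)).det)
      = A.det * ((A.submatrix Fin.succ Fin.succ).det *
            (A.submatrix Fin.castSucc Fin.castSucc).det
        - (A.submatrix Fin.castSucc Fin.succ).det *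
            (A.submatrix Fin.succ Fin.castSucc).det) := by
  set u : Fin (m + 2) → R := fun i => A.adjugate i 0
  set v : Fin (m + 2) → R := fun i => A.adjugate i (Fin.last (m + 1))
  set C : Matrix (Fin (m + 2)) (Fin (m + 2)) R :=
    ((1 : Matrix _ _ R).updateCol 0 u).updateCol (Fin.last (m + 1)) v
  have hC : C.det = u 0 * v (Fin.last _) - v 0 * u (Fin.last _) :=
    det_one_updateCol_updateCol (by simp [Fin.ext_iff]) u v
  have hu : A *ᵥ u = Pi.single 0 A.det := by
    ext i
    have := congrFun (congrFun (mul_adjugate A) i) 0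
    simpa [mul_apply, mulVec, dotProduct, u, one_apply, Pi.single_apply] using this
  have hv : A *ᵥ v = Pi.single (Fin.last _) A.det := by
    ext i
    have := congrFun (congrFun (mul_adjugate A) i) (Fin.last _)
    simpa [mul_apply, mulVec, dotProduct, v, one_apply, Pi.single_apply] using this
  have hAC : A * C = (A.updateCol 0 (Pi.single 0 A.det)).updateCol (Fin.last _)
      (Pi.single (Fin.last _) A.det) := by
    simp only [C, mul_updateCol, hu, hv, mul_one]
  have hdet : (A * C).det = A.det * (A.det * (A.submatrix (fun i : Fin m => i.succ.castSucc)
        (fun j : Fin m => j.succ.castSucc)).det) := by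
    rw [hAC, det_updateCol_zero_single_updateCol_last_single]
  have hu0 : u 0 = (A.submatrix Fin.succ Fin.succ).det := by
    simp only [u, adjugate_fin_succ_eq_det_submatrix]
    simp [Fin.succAbove_zero]
  have hvl : v (Fin.last _) = (A.submatrix Fin.castSucc Fin.castSucc).det := by
    simp only [v, adjugate_fin_succ_eq_det_submatrix]
    simp [Fin.succAbove_last, Even.neg_one_pow (⟨_, rfl⟩ : Even (m + 1 + (m + 1)))]
  have hv0 : v 0 = (-1) ^ (m + 1) * (A.submatrix Fin.castSucc Fin.succ).det := by
    simp only [v, adjugate_fin_succ_eq_det_submatrix]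
    simp [Fin.succAbove_last, Fin.succAbove_zero]
  have hul : u (Fin.last _) = (-1) ^ (m + 1) * (A.submatrix Fin.succ Fin.castSucc).det := by
    simp only [u, adjugate_fin_succ_eq_det_submatrix]
    simp [Fin.succAbove_last, Fin.succAbove_zero]
  rw [← hdet, det_mul, hC, hu0, hvl, hv0, hul]
  have h1 : ((-1 : R) ^ (m + 1)) * (-1) ^ (m + 1) = 1 := by
    rw [← pow_add]; exact Even.neg_one_pow ⟨_, rfl⟩
  linear_combination (-A.det * (A.submatrix Fin.castSucc Fin.succ).det *
    (A.submatrix Fin.succ Fin.castSucc).det) * h1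

/-- The Desnanot–Jacobi identity (Dodgson condensation). -/
theorem det_mul_det_inner {R : Type*} [CommRing R] (m : ℕ)
    (A : Matrix (Fin (m + 2)) (Fin (m + 2)) R) :
    A.det * (A.submatrix (fun i : Fin m => i.succ.castSucc)
        (fun j : Fin m => j.succ.castSucc)).det
      = (A.submatrix Fin.succ Fin.succ).det * (A.submatrix Fin.castSucc Fin.castSucc).det
        - (A.submatrix Fin.castSucc Fin.succ).det *
            (A.submatrix Fin.succ Fin.castSucc).det := by
  have h := mul_left_cancel₀ (Matrix.det_mvPolynomialX_ne_zero (Fin (m + 2)) ℤ)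
    (det_mul_det_mul_inner m (Matrix.mvPolynomialX (Fin (m + 2)) (Fin (m + 2)) ℤ))
  have h' := congrArg (MvPolynomial.aeval fun p : Fin (m + 2) × Fin (m + 2) => A p.1 p.2) h
  have hA := Matrix.mvPolynomialX_mapMatrix_aeval ℤ A
  simp only [map_sub, map_mul, AlgHom.map_det, AlgHom.mapMatrix_apply,
    ← Matrix.submatrix_map] at h' hA
  simpa only [hA] using h'

theorem sum_range_sign_sub (m a : ℕ) :
    ∑ k ∈ Finset.range m, Int.sign ((a : ℤ) - k) = if a < m then 2 * (a : ℤ) - m + 1 else m := by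
  induction m with
  | zero => simp
  | succ m ih =>
    rw [Finset.sum_range_succ, ih]
    rcases lt_trichotomy a m with h | h | h
    · rw [Int.sign_eq_neg_one_of_neg (by omega), if_pos h, if_pos (by omega)]
      push_cast; ring
    · subst h
      simp
      ring
    · rw [Int.sign_eq_one_of_pos (by omega), if_neg (by omega), if_neg (by omega)]
      push_cast; ring

theorem sum_sign_sub_perm {m : ℕ} (v : Equiv.Perm (Fin m)) (j : Fin m) :
    ∑ i, Int.sign (((v j : ℕ) : ℤ) - (v i : ℕ)) = 2 * ((v j : ℕ) : ℤ) - m + 1 := by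
  rw [Equiv.sum_comp v fun k : Fin m => Int.sign (((v j : ℕ) : ℤ) - (k : ℕ)),
    Fin.sum_univ_eq_sum_range fun k : ℕ => Int.sign (((v j : ℕ) : ℤ) - k),
    sum_range_sign_sub, if_pos (v j).isLt]

theorem sum_sum_mul_sign_perm {m : ℕ} (v : Equiv.Perm (Fin m)) :
    ∑ j : Fin m, ∑ i : Fin m, (((j : ℕ) : ℤ) - (i : ℕ)) * Int.sign (((v j : ℕ) : ℤ) - (v i : ℕ))
      = 2 * ∑ j : Fin m, ((j : ℕ) : ℤ) * (2 * ((v j : ℕ) : ℤ) - m + 1) := by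
  have h1 : ∑ j : Fin m, ∑ i : Fin m, ((j : ℕ) : ℤ) * Int.sign (((v j : ℕ) : ℤ) - (v i : ℕ))
      = ∑ j : Fin m, ((j : ℕ) : ℤ) * (2 * ((v j : ℕ) : ℤ) - m + 1) := by
    simp_rw [← Finset.mul_sum, sum_sign_sub_perm]
  have h2 : ∑ j : Fin m, ∑ i : Fin m, ((i : ℕ) : ℤ) * Int.sign (((v j : ℕ) : ℤ) - (v i : ℕ))
      = -∑ j : Fin m, ((j : ℕ) : ℤ) * (2 * ((v j : ℕ) : ℤ) - m + 1) := by
    rw [Finset.sum_comm, ← h1]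
    simp_rw [← Finset.sum_neg_distrib]
    refine Finset.sum_congr rfl fun j _ => Finset.sum_congr rfl fun i _ => ?_
    rw [← mul_neg, ← Int.sign_neg, neg_sub]
  simp_rw [sub_mul _ _ (Int.sign _), Finset.sum_sub_distrib, h1, h2]
  ring

theorem permBeta_eq_sum_sum {m : ℕ} (w : Equiv.Perm (Fin m)) :
    (permBeta w : ℤ) = ∑ j : Fin m, ∑ i : Fin m,
      if i < j ∧ w⁻¹ j < w⁻¹ i then ((j : ℕ) : ℤ) - (i : ℕ) else 0 := by
  rw [permBeta, Nat.cast_sum, Finset.sum_filter, Fintype.sum_prod_type, Finset.sum_comm]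
  refine Finset.sum_congr rfl fun j _ => Finset.sum_congr rfl fun i _ => ?_
  split_ifs with h
  · rw [Nat.cast_sub (by exact_mod_cast h.1.le)]
  · rfl

theorem permBeta_eq_sum {m : ℕ} (w : Equiv.Perm (Fin m)) :
    (permBeta w : ℤ) = ∑ j : Fin m, ((j : ℕ) : ℤ) ^ 2
      - ∑ j : Fin m, ((j : ℕ) : ℤ) * ((w j : ℕ) : ℤ) := by
  set v := w⁻¹
  have hswap : (permBeta w : ℤ) = ∑ j : Fin m, ∑ i : Fin m,
      if j < i ∧ v i < v j then ((i : ℕ) : ℤ) - (j : ℕ) else 0 := by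
    rw [permBeta_eq_sum_sum, Finset.sum_comm]
  have hdiff : ∑ j : Fin m, ∑ i : Fin m,
        (((j : ℕ) : ℤ) - (i : ℕ)) * Int.sign (((j : ℕ) : ℤ) - (i : ℕ))
      - ∑ j : Fin m, ∑ i : Fin m,
        (((j : ℕ) : ℤ) - (i : ℕ)) * Int.sign (((v j : ℕ) : ℤ) - (v i : ℕ))
      = 2 * permBeta w + 2 * permBeta w := by
    nth_rewrite 2 [hswap]
    rw [permBeta_eq_sum_sum]
    simp_rw [Finset.mul_sum, ← Finset.sum_sub_distrib, ← Finset.sum_add_distrib]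
    refine Finset.sum_congr rfl fun j _ => Finset.sum_congr rfl fun i _ => ?_
    rcases lt_trichotomy i j with h | h | h
    · have hne : v i ≠ v j := v.injective.ne h.ne
      have h' : (i : ℕ) < j := h
      rcases lt_or_gt_of_ne hne with hv | hv
      · have hv' : (v i : ℕ) < v j := hv
        rw [Int.sign_eq_one_of_pos (by omega), Int.sign_eq_one_of_pos (by omega),
          if_neg (fun H => lt_asymm hv H.2), if_neg (fun H => lt_asymm h H.1)]
        ring
      · have hv' : (v j : ℕ) < v i := hv
        rw [Int.sign_eq_one_of_pos (by omega), Int.sign_eq_neg_one_of_neg (by omega),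
          if_pos ⟨h, hv⟩, if_neg (fun H => lt_asymm h H.1)]
        ring
    · subst h; simp
    · have hne : v i ≠ v j := v.injective.ne h.ne'
      have h' : (j : ℕ) < i := h
      rcases lt_or_gt_of_ne hne with hv | hv
      · have hv' : (v i : ℕ) < v j := hv
        rw [Int.sign_eq_neg_one_of_neg (by omega), Int.sign_eq_one_of_pos (by omega),
          if_neg (fun H => lt_asymm h H.1), if_pos ⟨h, hv⟩]
        ring
      · have hv' : (v j : ℕ) < v i := hv
        rw [Int.sign_eq_neg_one_of_neg (by omega), Int.sign_eq_neg_one_of_neg (by omega),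
          if_neg (fun H => lt_asymm h H.1), if_neg (fun H => lt_asymm hv H.2)]
        ring
  have hid := sum_sum_mul_sign_perm (1 : Equiv.Perm (Fin m))
  simp only [Equiv.Perm.coe_one, id_eq] at hid
  rw [hid, sum_sum_mul_sign_perm v] at hdiff
  have hw : ∑ j : Fin m, ((j : ℕ) : ℤ) * ((v j : ℕ) : ℤ)
      = ∑ j : Fin m, ((j : ℕ) : ℤ) * ((w j : ℕ) : ℤ) := by
    rw [← Equiv.sum_comp w]
    refine Finset.sum_congr rfl fun j _ => ?_
    simp [v, mul_comm]
  have hsplit : ∀ f : Fin m → ℤ, ∑ j : Fin m, ((j : ℕ) : ℤ) * (2 * f j - m + 1)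
      = 2 * ∑ j : Fin m, ((j : ℕ) : ℤ) * f j + (1 - m) * ∑ j : Fin m, ((j : ℕ) : ℤ) := by
    intro f
    rw [Finset.mul_sum, Finset.mul_sum, ← Finset.sum_add_distrib]
    exact Finset.sum_congr rfl fun j _ => by ring
  rw [hsplit fun j => ((j : ℕ) : ℤ), hsplit fun j => ((v j : ℕ) : ℤ), hw] at hdiff
  simp_rw [pow_two]
  linarith

/-- Shifted squared displacements of a permutation sum to `2β(w)` plus a constant. -/
theorem sum_natAbs_sq_sub {m : ℕ} (w : Equiv.Perm (Fin m)) (c : ℤ) :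
    ∑ i : Fin m, ((((i : ℕ) : ℤ) - (w i : ℕ) - c) ^ 2).natAbs
      = 2 * permBeta w + m * (c ^ 2).natAbs := by
  zify
  simp only [abs_pow, sq_abs]
  have h1 : ∑ i : Fin m, ((w i : ℕ) : ℤ) = ∑ i : Fin m, ((i : ℕ) : ℤ) :=
    Equiv.sum_comp w fun i : Fin m => ((i : ℕ) : ℤ)
  have h2 : ∑ i : Fin m, ((w i : ℕ) : ℤ) ^ 2 = ∑ i : Fin m, ((i : ℕ) : ℤ) ^ 2 :=
    Equiv.sum_comp w fun i : Fin m => ((i : ℕ) : ℤ) ^ 2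
  have h3 : ∑ i : Fin m, (((i : ℕ) : ℤ) - (w i : ℕ) - c) ^ 2
      = ∑ i : Fin m, ((i : ℕ) : ℤ) ^ 2 + ∑ i : Fin m, ((w i : ℕ) : ℤ) ^ 2
        - 2 * ∑ i : Fin m, ((i : ℕ) : ℤ) * ((w i : ℕ) : ℤ)
        - 2 * c * ∑ i : Fin m, ((i : ℕ) : ℤ) + 2 * c * ∑ i : Fin m, ((w i : ℕ) : ℤ)
        + ∑ _i : Fin m, c ^ 2 := by
    simp only [Finset.mul_sum, ← Finset.sum_add_distrib, ← Finset.sum_sub_distrib]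
    exact Finset.sum_congr rfl fun i _ => by ring
  rw [h3, h1, h2, permBeta_eq_sum]
  simp
  ring

theorem neg_one_pow_permLen {R : Type*} [CommRing R] {m : ℕ} (w : Equiv.Perm (Fin m)) :
    (-1 : R) ^ permLen w = ((Equiv.Perm.sign w : ℤ) : R) := by
  have h : Equiv.Perm.sign w = (-1) ^ permLen w := by
    rw [← Equiv.Perm.sign_inv, Equiv.Perm.sign_eq_prod_prod_Ioi, permLen,
      ← Finset.prod_const, Finset.prod_filter, Fintype.prod_prod_type]
    refine Finset.prod_congr rfl fun i _ => ?_
    rw [← Finset.filter_lt_eq_Ioi, Finset.prod_filter]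
    refine Finset.prod_congr rfl fun j _ => ?_
    by_cases hij : i < j
    · have := (w⁻¹).injective.ne hij.ne
      rcases lt_or_gt_of_ne this with h | h
      · simp [hij, h, h.le, -Equiv.Perm.coe_inv]
      · simp [hij, h, lt_asymm h, -Equiv.Perm.coe_inv]
    · simp [hij]
  rw [h]
  simp

/-- Over a ring containing a square root of the parameter, `bdet` is an ordinary determinant. -/
theorem det_pow_sq_mul {R : Type*} [CommRing R] (r : R) (c : ℤ) {m : ℕ}
    (M : Matrix (Fin m) (Fin m) R) :
    (Matrix.of fun i j : Fin m => r ^ ((((i : ℕ) : ℤ) - (j : ℕ) - c) ^ 2).natAbs * M i j).det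
      = r ^ (m * (c ^ 2).natAbs) * bdet (r ^ 2) M := by
  rw [← Matrix.det_transpose, Matrix.det_apply', bdet, Finset.mul_sum]
  refine Finset.sum_congr rfl fun w _ => ?_
  simp only [Matrix.transpose_apply, Matrix.of_apply, Finset.prod_mul_distrib,
    Finset.prod_pow_eq_pow_sum, sum_natAbs_sq_sub, neg_one_pow_permLen, pow_add, pow_mul]
  ring

theorem map_bdet {R S : Type*} [CommRing R] [CommRing S] (f : R →+* S) (q : R) {m : ℕ}
    (M : Matrix (Fin m) (Fin m) R) : f (bdet q M) = bdet (f q) (M.map f) := by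
  simp [bdet]

theorem bdet_sq_mul_bdet_inner {R : Type*} [CommRing R] (r : R) (m : ℕ)
    (A : Matrix (Fin (m + 2)) (Fin (m + 2)) R) :
    bdet (r ^ 2) A *
        bdet (r ^ 2) (Matrix.of fun i j : Fin m => A i.succ.castSucc j.succ.castSucc)
      = bdet (r ^ 2) (Matrix.of fun i j : Fin (m + 1) => A i.succ j.succ) *
          bdet (r ^ 2) (Matrix.of fun i j : Fin (m + 1) => A i.castSucc j.castSucc)
        - (r ^ 2) ^ (m + 1) *
            bdet (r ^ 2) (Matrix.of fun i j : Fin (m + 1) => A i.castSucc j.succ) *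
            bdet (r ^ 2) (Matrix.of fun i j : Fin (m + 1) => A i.succ j.castSucc) := by
  have h := det_mul_det_inner m
    (Matrix.of fun i j : Fin (m + 2) =>
      r ^ ((((i : ℕ) : ℤ) - (j : ℕ) - 0) ^ 2).natAbs * A i j)
  have hsub : ∀ {k : ℕ} (c : ℤ) (f g : Fin k → Fin (m + 2)),
      (∀ i j, ((f i : ℕ) : ℤ) - (g j : ℕ) = (i : ℕ) - (j : ℕ) - c) →
      ((Matrix.of fun i j : Fin (m + 2) =>
        r ^ ((((i : ℕ) : ℤ) - (j : ℕ) - 0) ^ 2).natAbs * A i j).submatrix f g).det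
      = r ^ (k * (c ^ 2).natAbs) * bdet (r ^ 2) (Matrix.of fun i j => A (f i) (g j)) := by
    intro k c f g hfg
    rw [← det_pow_sq_mul]
    congr 1
    ext i j
    simp [hfg]
  rw [det_pow_sq_mul, hsub 0 _ _ (by simp), hsub 0 _ _ (by simp), hsub 0 _ _ (by simp),
    hsub 1 _ _ (by intros; simp; ring), hsub (-1) _ _ (by intros; simp; ring)] at h
  simp only [show ((0 : ℤ) ^ 2).natAbs = 0 from rfl, show ((1 : ℤ) ^ 2).natAbs = 1 from rfl,
    show ((-1 : ℤ) ^ 2).natAbs = 1 from rfl, mul_zero, mul_one, pow_zero, one_mul] at h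
  rw [h]
  ring

theorem exists_injective_ringHom_sq_eq.{u} {R : Type u} [CommRing R] (q : R) :
    ∃ (S : Type u) (_ : CommRing S) (f : R →+* S) (r : S),
      Function.Injective f ∧ f q = r ^ 2 := by
  rcases subsingleton_or_nontrivial R
  · exact ⟨R, inferInstance, RingHom.id R, 0, Function.injective_id, Subsingleton.elim _ _⟩
  refine ⟨AdjoinRoot (Polynomial.X ^ 2 - Polynomial.C q), inferInstance, AdjoinRoot.of _,
    AdjoinRoot.root _, ?_, ?_⟩
  · rw [injective_iff_map_eq_zero]
    intro a ha
    by_contra hne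
    rw [← AdjoinRoot.mk_C, AdjoinRoot.mk_eq_zero] at ha
    refine (Polynomial.monic_X_pow_sub_C q two_ne_zero).not_dvd_of_natDegree_lt
      (by simpa using hne) ?_ ha
    simp
  · have h := AdjoinRoot.eval₂_root (Polynomial.X ^ 2 - Polynomial.C q)
    simp only [Polynomial.eval₂_sub, Polynomial.eval₂_X_pow, Polynomial.eval₂_C] at h
    exact (sub_eq_zero.mp h).symm

/-- weighted condensation: for an n×n matrix A with n = m + 2 ≥ 2,
bdet(A)·bdet(A_{1n}^{1n}) = bdet(A₁¹)·bdet(Aₙⁿ) − q^{n−1}·bdet(Aₙ¹)·bdet(A₁ⁿ),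
where the submatrices delete the indicated first/last rows and columns. -/
theorem signed_bigrassmannian_stmt13 {R : Type*} [CommRing R] (q : R) (m : ℕ)
    (A : Matrix (Fin (m + 2)) (Fin (m + 2)) R) :
    bdet q A *
        bdet q (Matrix.of fun i j : Fin m => A i.succ.castSucc j.succ.castSucc)
      = bdet q (Matrix.of fun i j : Fin (m + 1) => A i.succ j.succ) *
          bdet q (Matrix.of fun i j : Fin (m + 1) => A i.castSucc j.castSucc)
        - q ^ (m + 1) *
            bdet q (Matrix.of fun i j : Fin (m + 1) => A i.castSucc j.succ) *
            bdet q (Matrix.of fun i j : Fin (m + 1) => A i.succ j.castSucc) := by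
  obtain ⟨S, _, f, r, hf, hq⟩ := exists_injective_ringHom_sq_eq q
  apply hf
  simp only [map_sub, map_mul, map_pow, map_bdet, hq]
  exact bdet_sq_mul_bdet_inner r m (A.map f)
end

section
/- Let R be a commutative ring, s ∈ R, q = s², and let A = (a_{ij}) be an n×n matrix over R with n ≥ 2. Let C be the n×n matrix with entries c_{ij} = s^{(i−j)²} a_{ij}. Then the ordinary determinant of the submatrix C_n^1 of C obtained by deleting row n and column 1 satisfies det(C_n^1) = s^{n−1}·bdet(A_n^1), where A_n^1 is the submatrix of A obtained by deleting row n and column 1. Likewise det(C_1^n) = s^{n−1}·bdet(A_1^n), where A_1^n is obtained by deleting row 1 and column n. -/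
theorem sum_sub_mul_indicator_lt {m : ℕ} (v : Equiv.Perm (Fin m)) :
    ∑ a : Fin m, ∑ b : Fin m, ((b : ℤ) - a) * (if v a < v b then 1 else 0)
      = ∑ b : Fin m, (b : ℤ) * (2 * (v b : ℤ) + 1 - m) := by
  have hlt : ∀ c : Fin m, ∑ a : Fin m, (if v a < c then (1 : ℤ) else 0) = c := by
    intro c
    rw [Equiv.sum_comp v (fun a => if a < c then (1 : ℤ) else 0)]
    simp [Finset.filter_gt_eq_Iio]
  have hgt : ∀ c : Fin m, ∑ b : Fin m, (if c < v b then (1 : ℤ) else 0) = m - 1 - c := by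
    intro c
    rw [Equiv.sum_comp v (fun b => if c < b then (1 : ℤ) else 0)]
    simp only [Finset.sum_boole, Finset.filter_lt_eq_Ioi, Fin.card_Ioi]
    have := c.isLt
    omega
  simp only [sub_mul, Finset.sum_sub_distrib]
  rw [Finset.sum_comm]
  simp only [← Finset.mul_sum, hlt, hgt]
  rw [← Finset.sum_sub_distrib]
  exact Finset.sum_congr rfl fun _ _ => by ring

theorem two_mul_permBeta {m : ℕ} (w : Equiv.Perm (Fin m)) :
    2 * (permBeta w : ℤ) = ∑ i : Fin m, ((i : ℤ) - w i) ^ 2 := by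
  have hβ : (permBeta w : ℤ) = ∑ a : Fin m, ∑ b : Fin m,
      if a < b ∧ w⁻¹ b < w⁻¹ a then (b : ℤ) - a else 0 := by
    rw [permBeta, Finset.sum_filter, Fintype.sum_prod_type]
    push_cast
    refine Finset.sum_congr rfl fun a _ => Finset.sum_congr rfl fun b _ => ?_
    split_ifs with h
    · have := h.1
      rw [Fin.lt_def] at this
      omega
    · rfl
  have hsymm : 2 * (permBeta w : ℤ) = ∑ a : Fin m, ∑ b : Fin m,
      (((b : ℤ) - a) * (if a < b then 1 else 0)
        - ((b : ℤ) - a) * (if w⁻¹ a < w⁻¹ b then 1 else 0)) := by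
    have hβ' := hβ
    rw [Finset.sum_comm] at hβ'
    rw [two_mul]
    nth_rewrite 1 [hβ]
    rw [hβ', ← Finset.sum_add_distrib]
    refine Finset.sum_congr rfl fun a _ => ?_
    rw [← Finset.sum_add_distrib]
    refine Finset.sum_congr rfl fun b _ => ?_
    generalize w⁻¹ = v
    rcases lt_trichotomy a b with h | rfl | h
    · rcases (v.injective.ne h.ne).lt_or_gt with h' | h' <;>
        simp [h, h', h.not_gt, h'.not_gt]
    · simp
    · rcases (v.injective.ne h.ne).lt_or_gt with h' | h' <;>
        simp [h, h', h.not_gt, h'.not_gt]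
  have hone : ∑ a : Fin m, ∑ b : Fin m, ((b : ℤ) - a) * (if a < b then 1 else 0)
      = ∑ b : Fin m, (b : ℤ) * (2 * (b : ℤ) + 1 - m) := sum_sub_mul_indicator_lt 1
  simp only [Finset.sum_sub_distrib] at hsymm
  rw [hsymm, hone, sum_sub_mul_indicator_lt, ← Finset.sum_sub_distrib,
    ← Equiv.sum_comp w⁻¹ fun i => ((i : ℤ) - w i) ^ 2]
  have hsq : ∑ b : Fin m, ((w⁻¹ b : Fin m) : ℤ) ^ 2 = ∑ b : Fin m, (b : ℤ) ^ 2 :=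
    Equiv.sum_comp w⁻¹ fun b : Fin m => (b : ℤ) ^ 2
  rw [← sub_eq_zero, ← Finset.sum_sub_distrib]
  rw [← sub_eq_zero, ← Finset.sum_sub_distrib] at hsq
  rw [← neg_eq_zero, ← Finset.sum_neg_distrib, ← hsq]
  refine Finset.sum_congr rfl fun b _ => ?_
  rw [show w (w⁻¹ b) = b from w.apply_symm_apply b]
  ring

theorem sum_sub_add_sq_eq {m : ℕ} (w : Equiv.Perm (Fin m)) (e : ℤ) (he : e ^ 2 = 1) :
    ∑ i : Fin m, ((i : ℤ) - w i + e) ^ 2 = m + 2 * permBeta w := by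
  have hsum : ∑ i : Fin m, ((i : ℤ) - w i) = 0 := by
    rw [Finset.sum_sub_distrib, Equiv.sum_comp w fun i : Fin m => (i : ℤ), sub_self]
  have hexp : ∀ i : Fin m, ((i : ℤ) - w i + e) ^ 2
      = ((i : ℤ) - w i) ^ 2 + 2 * e * ((i : ℤ) - w i) + 1 := fun i => by
    rw [← he]; ring
  simp only [hexp, Finset.sum_add_distrib, ← Finset.mul_sum, hsum, two_mul_permBeta]
  simp
  ring

/-- A determinant weighted by `s ^ (i - j ± 1)²` is a multiple of the bigrassmannian determinant. -/
theorem det_of_pow_shifted_sq_mul {R : Type*} [CommRing R] (s : R) {m : ℕ}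
    (B : Matrix (Fin m) (Fin m) R) (e : ℤ) (he : e ^ 2 = 1) :
    (Matrix.of fun i j : Fin m => s ^ (((i : ℤ) - j + e).natAbs ^ 2) * B i j).det
      = s ^ m * bdet (s ^ 2) B := by
  rw [← Matrix.det_transpose, Matrix.det_apply', bdet, Finset.mul_sum]
  refine Finset.sum_congr rfl fun w _ => ?_
  have hexp : ∑ i : Fin m, ((i : ℤ) - w i + e).natAbs ^ 2 = m + 2 * permBeta w := by
    zify
    simpa only [sq_abs] using sum_sub_add_sq_eq w e he
  simp only [Matrix.transpose_apply, Matrix.of_apply, Finset.prod_mul_distrib,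
    Finset.prod_pow_eq_pow_sum, hexp, neg_one_pow_permLen]
  ring

/-- let R be a commutative ring, s ∈ R, q = s², and A an n×n
matrix with n = m + 2 ≥ 2. With C the matrix c_{ij} = s^{(i−j)²} a_{ij}:
det(C_n^1) = s^{n−1}·bdet(A_n^1) and det(C_1^n) = s^{n−1}·bdet(A_1^n), where
the subscript/superscript indicate the deleted row/column. -/
theorem signed_bigrassmannian_stmt14 {R : Type*} [CommRing R] (s q : R)
    (hq : q = s ^ 2) (m : ℕ) (A : Matrix (Fin (m + 2)) (Fin (m + 2)) R)
    (C : Matrix (Fin (m + 2)) (Fin (m + 2)) R)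
    (hC : ∀ i j : Fin (m + 2),
      C i j = s ^ (((i : ℤ) - (j : ℤ)).natAbs ^ 2) * A i j) :
    (Matrix.of fun i j : Fin (m + 1) => C i.castSucc j.succ).det
        = s ^ (m + 1) *
            bdet q (Matrix.of fun i j : Fin (m + 1) => A i.castSucc j.succ) ∧
    (Matrix.of fun i j : Fin (m + 1) => C i.succ j.castSucc).det
        = s ^ (m + 1) *
            bdet q (Matrix.of fun i j : Fin (m + 1) => A i.succ j.castSucc) := by
  subst hq
  constructor
  · rw [← det_of_pow_shifted_sq_mul s _ (-1) (by norm_num)]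
    congr 1
    ext i j
    simp only [Matrix.of_apply, hC, Fin.val_castSucc, Fin.val_succ]
    congr 4
    push_cast
    ring
  · rw [← det_of_pow_shifted_sq_mul s _ 1 (by norm_num)]
    congr 1
    ext i j
    simp only [Matrix.of_apply, hC, Fin.val_castSucc, Fin.val_succ]
    congr 4
    push_cast
    ring
end
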